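/- Fix an integer m ≥ 1, let X be a real-valued random variable with E|X|^{m+1} < ∞, and let f : ℝ → ℝ be a polynomial function of degree at most m. Then E(X f(X)) = Σ_{s=0}^{m} (κ_{s+1}(X)/s!) · E(f^{(s)}(X)), where f^{(s)} denotes the s-th derivative of f (and f^{(0)} = f). -/

import Mathlib

open MeasureTheory Complex

/-- The characteristic function `φ_X(t) = E(e^{itX})` of a real random variable. -/
noncomputable def charFn {Ω : Type*} [MeasurableSpace Ω] (P : Measure Ω) (X : Ω → ℝ)
    (t : ℝ) : ℂ :=
  ∫ ω, Complex.exp (Complex.I * t * X ω) ∂P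

/-- The `j`-th cumulant `κ_j(X) = (-i)^j (d^j/dt^j) log φ_X(t)|_{t=0}` of a real random
variable (as a real number, via the real part). -/
noncomputable def cumulantRV {Ω : Type*} [MeasurableSpace Ω] (P : Measure Ω) (X : Ω → ℝ)
    (j : ℕ) : ℝ :=
  ((-Complex.I) ^ j * iteratedDeriv j (fun t : ℝ => Complex.log (charFn P X t)) 0).re

/-- The moment–cumulant recursion in terms of the derivatives of `log φ`, for a slit-plane valued
function `φ` of class `C^{n+1}` at the point. -/
lemma iteratedDeriv_succ_eq_sum_iteratedDeriv_clog {φ : ℝ → ℂ} {x : ℝ} {n : ℕ}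
    (hφ : ContDiffAt ℝ (n + 1) φ x) (hx : φ x ∈ slitPlane) :
    iteratedDeriv (n + 1) φ x = ∑ i ∈ Finset.range (n + 1),
      n.choose i * iteratedDeriv (i + 1) (fun t => Complex.log (φ t)) x *
        iteratedDeriv (n - i) φ x := by
  have hlog : ContDiffAt ℝ (n + 1) (fun t => Complex.log (φ t)) x :=
    ((Complex.contDiffAt_log hx).restrict_scalars ℝ).comp x hφ
  have hev : deriv φ =ᶠ[nhds x] fun t => deriv (fun t => Complex.log (φ t)) t * φ t := by
    have h1 : ∀ᶠ t in nhds x, φ t ∈ slitPlane :=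
      hφ.continuousAt.eventually (isOpen_slitPlane.mem_nhds hx)
    filter_upwards [h1, hφ.eventually (by simp)] with t ht hd
    have hd' : DifferentiableAt ℝ φ t := hd.differentiableAt (by simp)
    rw [(hd'.hasDerivAt.clog_real ht).deriv, div_mul_cancel₀ _ (slitPlane_ne_zero ht)]
  rw [iteratedDeriv_succ', hev.iteratedDeriv_eq,
    iteratedDeriv_fun_mul (ContDiffAt.derivWithin hlog le_rfl) (hφ.of_le (by simp))]
  simp_rw [← iteratedDeriv_succ']

lemma charFn_eq_charFun_map {Ω : Type*} [MeasurableSpace Ω] {P : Measure Ω} {X : Ω → ℝ}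
    (hX : AEMeasurable X P) : charFn P X = charFun (P.map X) := by
  ext t
  rw [charFun_apply_real, integral_map hX (by fun_prop), charFn]
  congr with ω
  ring_nf

lemma integral_pow_succ_eq_sum_cumulantRV {Ω : Type*} [MeasurableSpace Ω] {P : Measure Ω}
    [IsProbabilityMeasure P] {X : Ω → ℝ} (hX : AEMeasurable X P) {n : ℕ}
    (hmom : MemLp X (n + 1 : ℕ) P) :
    ∫ ω, X ω ^ (n + 1) ∂P = ∑ i ∈ Finset.range (n + 1),
      n.choose i * cumulantRV P X (i + 1) * ∫ ω, X ω ^ (n - i) ∂P := by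
  have : IsProbabilityMeasure (P.map X) := Measure.isProbabilityMeasure_map hX
  have hμ : MemLp id (n + 1 : ℕ) (P.map X) := by
    rwa [memLp_map_measure_iff (by fun_prop) hX]
  have hM (k : ℕ) (hk : k ≤ n + 1) :
      iteratedDeriv k (charFn P X) 0 = I ^ k * ((∫ ω, X ω ^ k ∂P : ℝ) : ℂ) := by
    rw [charFn_eq_charFun_map hX, iteratedDeriv_charFun_zero
      (hμ.mono_exponent (by exact_mod_cast hk)), integral_map hX (by fun_prop)]
  have hφ : ContDiffAt ℝ (n + 1) (charFn P X) 0 := by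
    rw [charFn_eq_charFun_map hX]
    exact_mod_cast (contDiff_charFun hμ).contDiffAt
  have h0 : charFn P X 0 = 1 := by simp [charFn]
  have key := iteratedDeriv_succ_eq_sum_iteratedDeriv_clog hφ (by simp [h0])
  rw [hM _ le_rfl] at key
  have hI (k : ℕ) : (-I) ^ k * I ^ k = 1 := by simp [← mul_pow]
  have hre := congrArg (fun z => ((-I) ^ (n + 1) * z).re) key
  simp only [← mul_assoc, hI, one_mul, ofReal_re] at hre
  rw [hre, Finset.mul_sum, re_sum]
  refine Finset.sum_congr rfl fun i hi => ?_
  have hi' : i ≤ n := Nat.lt_succ_iff.mp (Finset.mem_range.mp hi)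
  rw [hM _ (by lia), cumulantRV]
  have hsplit : (-I) ^ (n + 1) * I ^ (n - i) = (-I) ^ (i + 1) := by
    rw [show n + 1 = (i + 1) + (n - i) by lia, pow_add, mul_assoc, hI, mul_one]
  rw [← re_ofReal_mul, ← re_mul_ofReal, ← hsplit]
  congr 1
  push_cast
  ring

lemma integrable_polynomial_eval_of_memLp {Ω : Type*} [MeasurableSpace Ω] {P : Measure Ω}
    [IsFiniteMeasure P] {X : Ω → ℝ} {m : ℕ} (hmom : MemLp X m P)
    {f : Polynomial ℝ} (hf : f.natDegree ≤ m) : Integrable (fun ω => f.eval (X ω)) P := by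
  simp_rw [Polynomial.eval_eq_sum_range]
  refine integrable_finsetSum _ fun i hi => Integrable.const_mul ?_ _
  have hi' : i ≤ m := (Nat.lt_succ_iff.mp (Finset.mem_range.mp hi)).trans hf
  have := (hmom.mono_exponent (p := i) (by exact_mod_cast hi')).integrable_norm_pow'
  refine (integrable_norm_iff (hmom.aestronglyMeasurable.pow i)).mp ?_
  simpa using this

/-- If `m ≥ 1`, `E|X|^{m+1} < ∞` and `f` is a polynomial of degree at most `m`, then
`E(X f(X)) = ∑_{s=0}^m (κ_{s+1}(X)/s!) E(f^{(s)}(X))`. -/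
theorem barbour_polynomial_expansion {Ω : Type*} [MeasurableSpace Ω] (P : Measure Ω)
    [IsProbabilityMeasure P] (X : Ω → ℝ) (hX : Measurable X) (m : ℕ) (hm : 1 ≤ m)
    (hmom : Integrable (fun ω => |X ω| ^ (m + 1)) P)
    (f : Polynomial ℝ) (hf : f.natDegree ≤ m) :
    ∫ ω, X ω * f.eval (X ω) ∂P =
      ∑ s ∈ Finset.range (m + 1),
        cumulantRV P X (s + 1) / (Nat.factorial s : ℝ) *
          ∫ ω, (Polynomial.derivative^[s] f).eval (X ω) ∂P := by
  have hLp : MemLp X (m + 1 : ℕ) P := by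
    rw [← integrable_norm_rpow_iff hX.aestronglyMeasurable (by simp) (by simp)]
    simpa only [ENNReal.toReal_natCast, Real.rpow_natCast, Real.norm_eq_abs] using hmom
  have hint (g : Polynomial ℝ) (hg : g.natDegree ≤ m) (s : ℕ) :
      Integrable (fun ω => (Polynomial.derivative^[s] g).eval (X ω)) P :=
    integrable_polynomial_eval_of_memLp hLp
      ((Polynomial.natDegree_iterate_derivative g s).trans (by lia))
  have hint' (g : Polynomial ℝ) (hg : g.natDegree ≤ m) :
      Integrable (fun ω => X ω * g.eval (X ω)) P := by
    have h := integrable_polynomial_eval_of_memLp hLp (f := Polynomial.X * g)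
      (Polynomial.natDegree_mul_le.trans (by simp only [Polynomial.natDegree_X]; lia))
    simpa using h
  refine Polynomial.induction_with_natDegree_le (fun f => ∫ ω, X ω * f.eval (X ω) ∂P =
      ∑ s ∈ Finset.range (m + 1), cumulantRV P X (s + 1) / (Nat.factorial s : ℝ) *
          ∫ ω, (Polynomial.derivative^[s] f).eval (X ω) ∂P) m (by simp) ?_ ?_ f hf
  · intro n a _ hn
    have hrec := integral_pow_succ_eq_sum_cumulantRV hX.aemeasurable
      (hLp.mono_exponent (p := (n + 1 : ℕ)) (by exact_mod_cast Nat.succ_le_succ hn))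
    have hl (ω : Ω) : X ω * (Polynomial.C a * Polynomial.X ^ n).eval (X ω) =
        a * X ω ^ (n + 1) := by
      simp only [Polynomial.eval_mul, Polynomial.eval_C, Polynomial.eval_pow, Polynomial.eval_X]
      ring
    simp_rw [hl, Polynomial.iterate_derivative_C_mul, Polynomial.iterate_derivative_X_pow_eq_smul,
      Polynomial.eval_mul, Polynomial.eval_C, Polynomial.eval_smul, Polynomial.eval_pow,
      Polynomial.eval_X, smul_eq_mul, integral_const_mul]
    rw [hrec, Finset.mul_sum]
    refine Finset.sum_subset_zero_on_sdiff (by simpa using hn) (fun s hs => ?_) fun s _ => ?_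
    · have : n < s := by simp at hs; lia
      simp [Nat.descFactorial_of_lt this]
    · rw [Nat.descFactorial_eq_factorial_mul_choose]
      push_cast
      field_simp
  · intro g h hgh hh ihg ihh
    have hg' := hgh.le.trans hh
    simp_rw [iterate_map_add, Polynomial.eval_add, mul_add]
    rw [integral_add (hint' g hg') (hint' h hh), ihg, ihh, ← Finset.sum_add_distrib]
    refine Finset.sum_congr rfl fun s _ => ?_
    rw [integral_add (hint g hg' s) (hint h hh s), mul_add]
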